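/- arXiv:2304.05244 — 2 statements merged into one kernel-verified Lean document; each statement's English description precedes it below -/
import Mathlib

section
/- Let 0 < α < 1, ζ ≥ 0, β > 0, θ > 0, let M ≥ 1 be an integer, and let m^{(1)}, …, m^{(M)} ≥ 0 be integers with m = Σ_{i=1}^M m^{(i)} ≥ 1. Then (1/(θ Ψ_{α,ζ}(βM))) ∫₀^∞ [∏_{i=1}^M (βs)^{m^{(i)}} e^{−βs}/m^{(i)}!] · (θ s^{−α−1} e^{−ζs}/Γ(1−α)) ds = (1/(Ψ_{α,ζ}(βM) ∏_{i=1}^M m^{(i)}!)) · (Γ(m−α)/Γ(1−α)) · β^m/(βM+ζ)^{m−α}. -/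
open MeasureTheory

/-- Closed form of the mixed multivariate truncated slab distribution
`𝖲(m^{(1)},…,m^{(M)}|ρ)` in the Poisson spike-and-slab HIBP with generalized gamma
Lévy density `ρ(s) = θ s^{−α−1} e^{−ζs}/Γ(1−α)` and `ψ(M) = θ Ψ_{α,ζ}(βM)`, where
`Ψ_{α,ζ}(t) = ((t+ζ)^α − ζ^α)/α`: for `0 < α < 1`, `ζ ≥ 0`, `β, θ > 0`, `M ≥ 1`, and
nonnegative integers `m^{(i)}` with total `m ≥ 1`,
`(1/(θΨ_{α,ζ}(βM))) ∫₀^∞ [∏ᵢ (βs)^{m⁽ⁱ⁾} e^{−βs}/m⁽ⁱ⁾!] ρ(s) ds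
  = (1/(Ψ_{α,ζ}(βM) ∏ᵢ m⁽ⁱ⁾!)) (Γ(m−α)/Γ(1−α)) β^m/(βM+ζ)^{m−α}`. -/
theorem stmt_11 (α ζ β θ : ℝ) (hα0 : 0 < α) (hα1 : α < 1) (hζ : 0 ≤ ζ)
    (hβ : 0 < β) (hθ : 0 < θ) (M : ℕ) (hM : 1 ≤ M) (mv : Fin M → ℕ)
    (hm : 1 ≤ ∑ i, mv i) :
    (1 / (θ * (((β * (M : ℝ) + ζ) ^ α - ζ ^ α) / α))) *
        ∫ s in Set.Ioi (0 : ℝ),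
          (∏ i, ((β * s) ^ (mv i) * Real.exp (-β * s) / (Nat.factorial (mv i) : ℝ))) *
            (θ * s ^ (-α - 1) * Real.exp (-ζ * s) / Real.Gamma (1 - α))
      = (1 / ((((β * (M : ℝ) + ζ) ^ α - ζ ^ α) / α) * ∏ i, (Nat.factorial (mv i) : ℝ))) *
          (Real.Gamma (((∑ i, mv i : ℕ) : ℝ) - α) / Real.Gamma (1 - α)) *
          (β ^ (∑ i, mv i) / (β * (M : ℝ) + ζ) ^ (((∑ i, mv i : ℕ) : ℝ) - α)) := by
  have hmR : (1 : ℝ) ≤ ((∑ i, mv i : ℕ) : ℝ) := by exact_mod_cast hm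
  have hMR : (1 : ℝ) ≤ (M : ℝ) := by exact_mod_cast hM
  generalize hmm : (∑ i, mv i) = m at hmR ⊢
  have hr : 0 < β * (M : ℝ) + ζ := by positivity
  have ha : 0 < (m : ℝ) - α := by linarith
  have key := Real.integral_rpow_mul_exp_neg_mul_Ioi ha hr
  have hint : ∫ s in Set.Ioi (0 : ℝ),
          (∏ i, ((β * s) ^ (mv i) * Real.exp (-β * s) / (Nat.factorial (mv i) : ℝ))) *
            (θ * s ^ (-α - 1) * Real.exp (-ζ * s) / Real.Gamma (1 - α))
      = ∫ s in Set.Ioi (0 : ℝ),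
          (β ^ m * θ / ((∏ i, (Nat.factorial (mv i) : ℝ)) * Real.Gamma (1 - α))) *
          (s ^ ((m : ℝ) - α - 1) * Real.exp (-((β * (M : ℝ) + ζ) * s))) := by
    refine setIntegral_congr_fun measurableSet_Ioi (fun s hs => ?_)
    have hs0 : 0 < s := hs
    have e1 : s ^ ((m : ℝ) - α - 1) = s ^ m * s ^ (-α - 1) := by
      rw [← Real.rpow_natCast s m, ← Real.rpow_add hs0]
      congr 1
      ring
    have e2 : Real.exp (-((β * (M : ℝ) + ζ) * s))
        = Real.exp (-β * s) ^ M * Real.exp (-ζ * s) := by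
      rw [← Real.exp_nat_mul, ← Real.exp_add]
      congr 1
      ring
    have e3 : (∏ i, ((β * s) ^ (mv i) * Real.exp (-β * s) / (Nat.factorial (mv i) : ℝ)))
        = β ^ m * s ^ m * Real.exp (-β * s) ^ M / ∏ i, (Nat.factorial (mv i) : ℝ) := by
      rw [Finset.prod_div_distrib, Finset.prod_mul_distrib, Finset.prod_pow_eq_pow_sum, hmm,
        mul_pow]
      simp
    simp only [e1, e2, e3]
    rw [div_mul_div_comm, div_mul_eq_mul_div]
    congr 1
    ring
  rw [hint, integral_const_mul, key, Real.div_rpow zero_le_one hr.le, Real.one_rpow]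
  generalize ((β * (M : ℝ) + ζ) ^ α - ζ ^ α) / α = P
  generalize (∏ i, (Nat.factorial (mv i) : ℝ)) = F
  simp only [div_eq_mul_inv, mul_inv, one_mul]
  have ht : θ⁻¹ * θ = 1 := inv_mul_cancel₀ hθ.ne'
  linear_combination (P⁻¹ * β ^ m * F⁻¹ * (Real.Gamma (1 - α))⁻¹ *
    ((β * (M : ℝ) + ζ) ^ ((m : ℝ) - α))⁻¹ * Real.Gamma ((m : ℝ) - α)) * ht
end

section
/- Let 0 < α < 1, ζ ≥ 0, let J ≥ 1 and κ₁, …, κ_J > 0 with κ = Σ_{j=1}^J κ_j, and let n₁, …, n_J ≥ 0 be integers with n = Σ_{j=1}^J n_j ≥ 1. Then ∫₀^∞ (λ^{−α−1} e^{−ζλ}/(Γ(1−α) Ψ_{α,ζ}(κ))) · ((κλ)^n e^{−κλ}/n!) dλ · (n!/∏_{j=1}^J n_j!) ∏_{j=1}^J (κ_j/κ)^{n_j} = (1/Ψ_{α,ζ}(κ)) · (Γ(n−α)/Γ(1−α)) · (κ+ζ)^{α−n} · ∏_{j=1}^J κ_j^{n_j}/n_j!. -/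
open MeasureTheory

/-- Joint pmf of the multivariate mixed zero-truncated Poisson distribution
`MtP((κⱼ), ν_{α,ζ})` for the generalized gamma Lévy density
`ν_{α,ζ}(λ) = λ^{−α−1} e^{−ζλ}/Γ(1−α)`, `Ψ_{α,ζ}(κ) = ((κ+ζ)^α − ζ^α)/α`:
for `0 < α < 1`, `ζ ≥ 0`, `J ≥ 1`, `κ₁,…,κ_J > 0` with total `κ`, and nonnegative
integers `n₁,…,n_J` with total `n ≥ 1`,
`[∫₀^∞ (ν_{α,ζ}(λ)/Ψ_{α,ζ}(κ)) ((κλ)^n e^{−κλ}/n!) dλ] (n!/∏ nⱼ!) ∏ (κⱼ/κ)^{nⱼ}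
  = (1/Ψ_{α,ζ}(κ)) (Γ(n−α)/Γ(1−α)) (κ+ζ)^{α−n} ∏ κⱼ^{nⱼ}/nⱼ!`. -/
theorem stmt_12 (α ζ : ℝ) (hα0 : 0 < α) (hα1 : α < 1) (hζ : 0 ≤ ζ)
    (J : ℕ) (hJ : 1 ≤ J) (κv : Fin J → ℝ) (hκv : ∀ j, 0 < κv j)
    (nv : Fin J → ℕ) (hn : 1 ≤ ∑ j, nv j) :
    (∫ l in Set.Ioi (0 : ℝ),
          (l ^ (-α - 1) * Real.exp (-ζ * l) /
              (Real.Gamma (1 - α) * ((((∑ j, κv j) + ζ) ^ α - ζ ^ α) / α))) *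
            (((∑ j, κv j) * l) ^ (∑ j, nv j) * Real.exp (-(∑ j, κv j) * l) /
              (Nat.factorial (∑ j, nv j) : ℝ))) *
        ((Nat.factorial (∑ j, nv j) : ℝ) / ∏ j, (Nat.factorial (nv j) : ℝ)) *
        (∏ j, (κv j / (∑ j', κv j')) ^ (nv j))
      = (1 / ((((∑ j, κv j) + ζ) ^ α - ζ ^ α) / α)) *
          (Real.Gamma (((∑ j, nv j : ℕ) : ℝ) - α) / Real.Gamma (1 - α)) *
          ((∑ j, κv j) + ζ) ^ (α - ((∑ j, nv j : ℕ) : ℝ)) *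
          ∏ j, ((κv j) ^ (nv j) / (Nat.factorial (nv j) : ℝ)) := by
  have hJ' : (Finset.univ : Finset (Fin J)).Nonempty := ⟨⟨0, hJ⟩, Finset.mem_univ _⟩
  have hκ : 0 < ∑ j, κv j := Finset.sum_pos (fun j _ => hκv j) hJ'
  have hprod : ∏ j, (κv j / (∑ j', κv j')) ^ (nv j)
      = (∏ j, κv j ^ nv j) / (∑ j, κv j) ^ (∑ j, nv j) := by
    simp only [div_pow, Finset.prod_div_distrib, Finset.prod_pow_eq_pow_sum]
  rw [hprod, Finset.prod_div_distrib]
  generalize (∑ j, κv j) = κ at *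
  generalize (∑ j, nv j) = n at *
  have hF : (∏ j, (Nat.factorial (nv j) : ℝ)) ≠ 0 :=
    Finset.prod_ne_zero_iff.mpr fun j _ => by positivity
  generalize (∏ j, (Nat.factorial (nv j) : ℝ)) = F at *
  generalize (∏ j, κv j ^ nv j) = P at *
  generalize ((κ + ζ) ^ α - ζ ^ α) / α = Ψ
  have hn' : (1 : ℝ) ≤ n := by exact_mod_cast hn
  have hκζ : 0 < κ + ζ := by linarith
  have hint : (∫ l in Set.Ioi (0 : ℝ),
          (l ^ (-α - 1) * Real.exp (-ζ * l) / (Real.Gamma (1 - α) * Ψ)) *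
            ((κ * l) ^ n * Real.exp (-κ * l) / (Nat.factorial n : ℝ)))
      = (κ ^ n / (Real.Gamma (1 - α) * Ψ * (Nat.factorial n : ℝ))) *
        ((1 / (κ + ζ)) ^ ((n : ℝ) - α) * Real.Gamma ((n : ℝ) - α)) := by
    rw [← Real.integral_rpow_mul_exp_neg_mul_Ioi (by linarith) hκζ, ← integral_const_mul]
    refine setIntegral_congr_fun measurableSet_Ioi fun l hl => ?_
    have hl : 0 < l := hl
    have h1 : l ^ ((n : ℝ) - α - 1) = l ^ (-α - 1) * l ^ n := by
      rw [← Real.rpow_natCast l n, ← Real.rpow_add hl]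
      congr 1
      ring
    have h2 : Real.exp (-((κ + ζ) * l)) = Real.exp (-ζ * l) * Real.exp (-κ * l) := by
      rw [← Real.exp_add]
      congr 1
      ring
    simp only [h1, h2, mul_pow]
    ring
  have hpow : (1 / (κ + ζ)) ^ ((n : ℝ) - α) = (κ + ζ) ^ (α - (n : ℝ)) := by
    rw [one_div, Real.inv_rpow hκζ.le, ← Real.rpow_neg hκζ.le, neg_sub]
  rw [hint, hpow]
  have hf : (Nat.factorial n : ℝ) ≠ 0 := by positivity
  have hκn : κ ^ n ≠ 0 := by positivity
  have e : ∀ G Ψ f K R Γn F P : ℝ, f ≠ 0 → K ≠ 0 →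
      K / (G * Ψ * f) * (R * Γn) * (f / F) * (P / K)
        = 1 / Ψ * (Γn / G) * R * (P / F) := by
    intro G Ψ f K R Γn F P hf hK
    have : K / (G * Ψ * f) * (R * Γn) * (f / F) * (P / K)
        = (K * K⁻¹) * (f * f⁻¹) * (1 / Ψ * (Γn / G) * R * (P / F)) := by
      simp only [div_eq_mul_inv, mul_inv]
      ring
    rw [this, mul_inv_cancel₀ hf, mul_inv_cancel₀ hK]
    ring
  exact e _ _ _ _ _ _ _ _ hf hκn
end
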